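/- arXiv:quant-ph/0605197 — 5 statements merged into one kernel-verified Lean document; each statement's English description precedes it below -/
import Mathlib

section
/- Let τ : X → X be a map on a compact topological space X, and let S : X → ℝ be a continuous function such that S(τ(x)) ≥ S(x) for all x ∈ X, and such that for some fixed natural number N and some x* ∈ X one has S(τᴺ(x)) > S(x) for all x ≠ x*. Then S is a generalized Lyapunov function for τ around x*: the sequence S(τⁿ(x)) converges for every x ∈ X and its limit differs from S(x) for every x ≠ x*. -/
open Filter Topology

/-- A continuous `S : X → ℝ` is a generalized Lyapunov function for `τ` around `xs` iff
the sequence `S (τ^[n] x)` converges for every `x` and its limit differs from `S x`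
for every `x ≠ xs`. -/
def IsGenLyapunov {X : Type*} [TopologicalSpace X] (τ : X → X) (S : X → ℝ) (xs : X) : Prop :=
  Continuous S ∧
  (∀ x : X, ∃ L : ℝ, Tendsto (fun n => S (τ^[n] x)) atTop (𝓝 L)) ∧
  (∀ x : X, x ≠ xs → ∀ L : ℝ, Tendsto (fun n => S (τ^[n] x)) atTop (𝓝 L) → L ≠ S x)

/-- If `S` does not decrease under `τ`, then it is monotone along the orbits of `τ`. -/
theorem monotone_comp_iterate {X : Type*} {τ : X → X} {S : X → ℝ}
    (hmono : ∀ x : X, S x ≤ S (τ x)) (x : X) : Monotone fun n => S (τ^[n] x) :=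
  monotone_nat_of_le_succ fun n => by
    simpa only [Function.iterate_succ_apply'] using hmono (τ^[n] x)

/-- On a compact topological space, a continuous function `S` which is
non-decreasing along orbits of `τ` and strictly increasing after `N` steps at every
`x ≠ xs` is a generalized Lyapunov function for `τ` around `xs`: the sequence
`S (τ^[n] x)` converges for every `x` and its limit differs from `S x` for `x ≠ xs`. -/
theorem genLyapunov_of_strict_after_N {X : Type*} [TopologicalSpace X] [CompactSpace X]
    (τ : X → X) (S : X → ℝ) (hS : Continuous S) (N : ℕ) (xs : X)
    (hmono : ∀ x : X, S x ≤ S (τ x))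
    (hstrict : ∀ x : X, x ≠ xs → S x < S (τ^[N] x)) :
    IsGenLyapunov τ S xs := by
  refine ⟨hS, fun x => ?_, fun x hx L hL => ?_⟩
  · refine ⟨_, tendsto_atTop_ciSup (monotone_comp_iterate hmono x) ?_⟩
    exact (isCompact_range hS).bddAbove.mono
      (Set.range_subset_iff.2 fun n => Set.mem_range_self (τ^[n] x))
  · exact ((hstrict x hx).trans_le
      ((monotone_comp_iterate hmono x).ge_of_tendsto hL N)).ne'
end

section
/- Let X be a sequentially compact topological space, let τ : X → X be continuous, and let S : X → ℝ be a generalized Lyapunov function for τ around x* ∈ X (i.e. S is continuous, S(τⁿ(x)) converges for every x, and limₙ S(τⁿ(x)) ≠ S(x) for all x ≠ x*). Then τ is mixing with fixed point x*: for every x ∈ X the sequence τⁿ(x) converges to x*, and τ(x*) = x*. -/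
open Filter Topology

/-- Every limit of a subsequence of an orbit is the center of the generalized Lyapunov function. -/
theorem IsGenLyapunov.eq_of_tendsto_subseq {X : Type*} [TopologicalSpace X]
    {τ : X → X} (hτ : Continuous τ) {S : X → ℝ} {xs : X} (hLyap : IsGenLyapunov τ S xs)
    {x y : X} {φ : ℕ → ℕ} (hφ : Tendsto φ atTop atTop)
    (hy : Tendsto (fun k => τ^[φ k] x) atTop (𝓝 y)) : y = xs := by
  obtain ⟨hS, hconv, hne⟩ := hLyap
  obtain ⟨L, hL⟩ := hconv x
  have hconst (m : ℕ) : S (τ^[m] y) = L := by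
    have h₁ : Tendsto (fun k => S (τ^[m] (τ^[φ k] x))) atTop (𝓝 (S (τ^[m] y))) :=
      ((hS.comp (hτ.iterate m)).tendsto y).comp hy
    have h₂ : Tendsto (fun k => S (τ^[m] (τ^[φ k] x))) atTop (𝓝 L) := by
      simp only [← Function.iterate_add_apply]
      exact hL.comp (tendsto_atTop_mono (fun k => Nat.le_add_left (φ k) m) hφ)
    exact tendsto_nhds_unique h₁ h₂
  by_contra hyx
  refine hne y hyx L ?_ (hconst 0).symm
  simp only [hconst, tendsto_const_nhds]

/-- **Generalized Lyapunov theorem.** If `τ` is a continuous map on a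
sequentially compact topological space admitting a generalized Lyapunov function around
`xs`, then `τ` is mixing with fixed point `xs`: every orbit converges to `xs`, and
`τ xs = xs`. -/
theorem mixing_of_genLyapunov {X : Type*} [TopologicalSpace X] [SeqCompactSpace X]
    (τ : X → X) (hτ : Continuous τ) (S : X → ℝ) (xs : X)
    (hLyap : IsGenLyapunov τ S xs) :
    (∀ x : X, Tendsto (fun n => τ^[n] x) atTop (𝓝 xs)) ∧ τ xs = xs := by
  have hlim (x : X) : Tendsto (fun n => τ^[n] x) atTop (𝓝 xs) := by
    refine tendsto_of_subseq_tendsto fun ns hns => ?_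
    obtain ⟨y, φ, hφ, hy⟩ := SeqCompactSpace.tendsto_subseq fun k => τ^[ns k] x
    obtain rfl := hLyap.eq_of_tendsto_subseq hτ (hns.comp hφ.tendsto_atTop) hy
    exact ⟨φ, hy⟩
  refine ⟨hlim, hLyap.eq_of_tendsto_subseq hτ (x := xs) (tendsto_add_atTop_nat 1) ?_⟩
  simp only [Function.iterate_succ_apply']
  exact (hτ.tendsto xs).comp (hlim xs)
end

section
/- Let X be a sequentially compact topological space, τ : X → X continuous, and let S : X → ℝ be a multi-central Lyapunov function for τ around a subset F ⊆ X, i.e. S is continuous, S(τⁿ(x)) converges for every x ∈ X, S is constant on F, τ(F) ⊆ F, and limₙ S(τⁿ(x)) ≠ S(x) for all x ∉ F. Let X/F be the quotient topological space obtained by identifying all points of F to a single point [F], with quotient map φ : X → X/F. Then the induced map τ̃ : X/F → X/F, defined by τ̃([x]) = [τ(x)] (which is well defined since τ(F) ⊆ F), is continuous and mixing with fixed point [F]: for every class [x] ∈ X/F the sequence τ̃ⁿ([x]) converges to [F]. -/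
open Filter Topology

/-- The equivalence relation on `X` identifying all points of `F` with each other
(and each point outside `F` only with itself). -/
def collapseSetoid {X : Type*} (F : Set X) : Setoid X where
  r a b := a = b ∨ (a ∈ F ∧ b ∈ F)
  iseqv := by
    constructor
    · intro a; exact Or.inl rfl
    · rintro a b (rfl | ⟨ha, hb⟩)
      · exact Or.inl rfl
      · exact Or.inr ⟨hb, ha⟩
    · rintro a b c (rfl | ⟨ha, hb⟩) (rfl | ⟨hb', hc⟩)
      · exact Or.inl rfl
      · exact Or.inr ⟨hb', hc⟩
      · exact Or.inr ⟨ha, hb⟩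
      · exact Or.inr ⟨ha, hc⟩

/-- Any limit point of an orbit of `τ` along which `S` converges has an orbit on which `S` is
constant. -/
theorem lyapunov_iterate_eq_of_tendsto_orbit {X : Type*} [TopologicalSpace X] {τ : X → X}
    (hτ : Continuous τ) {S : X → ℝ} (hS : Continuous S) {x z : X} {L : ℝ}
    (hL : Tendsto (fun n => S (τ^[n] x)) atTop (𝓝 L)) {u : ℕ → ℕ} (hu : Tendsto u atTop atTop)
    (hz : Tendsto (fun k => τ^[u k] x) atTop (𝓝 z)) (n : ℕ) : S (τ^[n] z) = L := by
  have hlim : Tendsto (fun k => S (τ^[n] (τ^[u k] x))) atTop (𝓝 (S (τ^[n] z))) :=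
    ((hS.comp (hτ.iterate n)).tendsto z).comp hz
  refine tendsto_nhds_unique hlim ?_
  simp only [← Function.iterate_add_apply]
  exact hL.comp (tendsto_atTop_mono (fun k => Nat.le_add_left (u k) n) hu)

/-- **Multi-central Lyapunov function.** Let `τ` be a continuous map on a
sequentially compact topological space and `S` a multi-central Lyapunov function for `τ`
around `F ⊆ X` (i.e. `S` is continuous, `S (τ^[n] x)` converges for every `x`, `S` is
constant on `F`, `τ F ⊆ F`, and the orbit-limit of `S` differs from `S x` for every
`x ∉ F`). Then any map `τt` on the quotient space `X/F` induced by `τ` (i.e. satisfying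
`τt ⟦x⟧ = ⟦τ x⟧`) is continuous and mixing with fixed point `[F]`: every orbit of `τt`
converges to the class `[F]` of the points of `F`. -/
theorem multicentral_lyapunov {X : Type*} [TopologicalSpace X] [SeqCompactSpace X]
    (τ : X → X) (hτ : Continuous τ) (F : Set X) (S : X → ℝ) (hS : Continuous S)
    (hconv : ∀ x : X, ∃ L : ℝ, Tendsto (fun n => S (τ^[n] x)) atTop (𝓝 L))
    (hconst : ∀ a ∈ F, ∀ b ∈ F, S a = S b)
    (hmapsTo : Set.MapsTo τ F F)
    (hgap : ∀ x : X, x ∉ F → ∀ L : ℝ,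
      Tendsto (fun n => S (τ^[n] x)) atTop (𝓝 L) → L ≠ S x)
    (y : X) (hy : y ∈ F)
    (τt : Quotient (collapseSetoid F) → Quotient (collapseSetoid F))
    (hτt : ∀ x : X, τt (Quotient.mk (collapseSetoid F) x) =
      Quotient.mk (collapseSetoid F) (τ x)) :
    Continuous τt ∧
      ∀ q : Quotient (collapseSetoid F),
        Tendsto (fun n => τt^[n] q) atTop (𝓝 (Quotient.mk (collapseSetoid F) y)) := by
  have hiter (n : ℕ) (x : X) : τt^[n] (Quotient.mk _ x) = Quotient.mk _ (τ^[n] x) :=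
    ((Function.Semiconj.iterate_right (f := Quotient.mk (collapseSetoid F))
      (fun x => (hτt x).symm) n).eq x).symm
  refine ⟨?_, ?_⟩
  · rw [isQuotientMap_quotient_mk'.continuous_iff]
    exact (continuous_quotient_mk'.comp hτ).congr fun x => (hτt x).symm
  · intro q
    induction q using Quotient.inductionOn with | _ x
    simp only [hiter]
    refine tendsto_of_subseq_tendsto fun u hu => ?_
    obtain ⟨z, φ, hφ, hz⟩ := SeqCompactSpace.tendsto_subseq fun k => τ^[u k] x
    obtain ⟨L, hL⟩ := hconv x
    have hSz := lyapunov_iterate_eq_of_tendsto_orbit hτ hS hL (hu.comp hφ.tendsto_atTop) hz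
    have hzF : z ∈ F := by
      by_contra hzF
      refine hgap z hzF L ?_ (hSz 0).symm
      simp only [hSz, tendsto_const_nhds]
    have hzy : Quotient.mk (collapseSetoid F) z = Quotient.mk (collapseSetoid F) y :=
      Quotient.sound (Or.inr ⟨hzF, hy⟩)
    refine ⟨φ, ?_⟩
    rw [← hzy]
    exact (continuous_quotient_mk'.tendsto z).comp hz
end

section
/- Let X be a compact metric space and let τ : X → X be a continuous map. Then τ is mixing with fixed point x* (i.e. τ(x*) = x* and limₙ τⁿ(x) = x* for every x ∈ X) if and only if there exists a generalized Lyapunov function for τ around x*, i.e. a continuous S : X → ℝ such that S(τⁿ(x)) converges for every x ∈ X and limₙ S(τⁿ(x)) ≠ S(x) for all x ≠ x*. In particular, if τ is mixing with fixed point x*, then S(x) = d(x*, x) is such a function. -/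
open Filter Topology

/-- If `S` converges along the orbit of `x`, then at every cluster point `y` of that orbit
`S` is constant, equal to the limit, along the whole orbit of `y`. -/
theorem apply_iterate_eq_of_mapClusterPt {X Y : Type*} [TopologicalSpace X] [TopologicalSpace Y]
    [T2Space Y] {τ : X → X} (hτ : Continuous τ) {S : X → Y} (hS : Continuous S) {x y : X} {L : Y}
    (hL : Tendsto (fun n => S (τ^[n] x)) atTop (𝓝 L))
    (hy : MapClusterPt y atTop (fun n => τ^[n] x)) (m : ℕ) : S (τ^[m] y) = L := by
  have hclust : MapClusterPt (S (τ^[m] y)) atTop (fun n => S (τ^[m + n] x)) := by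
    simpa only [Function.comp_def, Function.iterate_add_apply] using
      hy.continuousAt_comp (hS.comp (hτ.iterate m)).continuousAt
  have hshift : Tendsto (fun n => S (τ^[m + n] x)) atTop (𝓝 L) :=
    hL.comp (tendsto_atTop_mono (fun n => Nat.le_add_left n m) tendsto_id)
  exact eq_of_nhds_neBot (ClusterPt.mono hclust hshift)

/-- Along a continuous self-map of a compact space with a generalized Lyapunov function
around `xs`, every orbit converges to `xs`. -/
theorem IsGenLyapunov.tendsto_iterate {X : Type*} [TopologicalSpace X] [CompactSpace X]
    {τ : X → X} (hτ : Continuous τ) {S : X → ℝ} {xs : X} (h : IsGenLyapunov τ S xs) (x : X) :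
    Tendsto (fun n => τ^[n] x) atTop (𝓝 xs) := by
  obtain ⟨hS, hconv, hne⟩ := h
  obtain ⟨L, hL⟩ := hconv x
  refine le_nhds_of_unique_clusterPt fun y hy => ?_
  by_contra hyx
  have hconst := apply_iterate_eq_of_mapClusterPt hτ hS hL hy
  refine hne y hyx L ?_ (hconst 0).symm
  simp only [hconst, tendsto_const_nhds]

/-- If every orbit converges to `xs`, the distance to `xs` is a generalized Lyapunov function. -/
theorem isGenLyapunov_dist {X : Type*} [MetricSpace X] {τ : X → X} {xs : X}
    (h : ∀ x : X, Tendsto (fun n => τ^[n] x) atTop (𝓝 xs)) :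
    IsGenLyapunov τ (fun x => dist xs x) xs := by
  have hlim (x : X) : Tendsto (fun n => dist xs (τ^[n] x)) atTop (𝓝 0) := by
    simpa only [dist_self] using tendsto_const_nhds (x := xs) |>.dist (h x)
  refine ⟨by fun_prop, fun x => ⟨0, hlim x⟩, fun x hx L hL => ?_⟩
  rw [tendsto_nhds_unique hL (hlim x)]
  exact (dist_pos.2 hx.symm).ne

/-- **Lyapunov criterion.** A continuous map `τ` on a compact metric space
is mixing with fixed point `xs` if and only if there exists a generalized Lyapunov
function for `τ` around `xs`.  In particular, if `τ` is mixing with fixed point `xs`,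
then `S x = dist xs x` is such a function. -/
theorem mixing_iff_genLyapunov {X : Type*} [MetricSpace X] [CompactSpace X]
    (τ : X → X) (hτ : Continuous τ) (xs : X) :
    ((τ xs = xs ∧ ∀ x : X, Tendsto (fun n => τ^[n] x) atTop (𝓝 xs)) ↔
      ∃ S : X → ℝ, IsGenLyapunov τ S xs) ∧
    ((∀ x : X, Tendsto (fun n => τ^[n] x) atTop (𝓝 xs)) →
      IsGenLyapunov τ (fun x => dist xs x) xs) := by
  refine ⟨⟨fun h => ⟨_, isGenLyapunov_dist h.2⟩, ?_⟩, isGenLyapunov_dist⟩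
  rintro ⟨S, hS⟩
  have hlim := hS.tendsto_iterate hτ
  exact ⟨isFixedPt_of_tendsto_iterate (hlim xs) hτ.continuousAt, hlim⟩
end

section
/- Let X be a compact metric space and let τ : X → X be a continuous map having at least one fixed point. Then τ is mixing (there exists x* such that τⁿ(x) → x* for every x ∈ X) if and only if τ is an asymptotic deformation, i.e. for all x, y ∈ X the sequence d(τⁿ(x), τⁿ(y)) converges, and limₙ d(τⁿ(x), τⁿ(y)) ≠ d(x, y) whenever x ≠ y. -/
open Filter Topology

/-- **Asymptotic deformations.** A continuous map `τ` on a compact metric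
space having at least one fixed point is mixing (some `xs` attracts every orbit) if and
only if `τ` is an asymptotic deformation: for all `x, y` the sequence
`dist (τ^[n] x) (τ^[n] y)` converges, and for `x ≠ y` its limit differs from
`dist x y`. -/
theorem mixing_iff_asymptotic_deformation {X : Type*} [MetricSpace X] [CompactSpace X]
    (τ : X → X) (hτ : Continuous τ) (hfix : ∃ x : X, τ x = x) :
    (∃ xs : X, ∀ x : X, Tendsto (fun n => τ^[n] x) atTop (𝓝 xs)) ↔
      ((∀ x y : X, ∃ L : ℝ,
          Tendsto (fun n => dist (τ^[n] x) (τ^[n] y)) atTop (𝓝 L)) ∧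
        (∀ x y : X, x ≠ y → ∀ L : ℝ,
          Tendsto (fun n => dist (τ^[n] x) (τ^[n] y)) atTop (𝓝 L) → L ≠ dist x y)) := by
  constructor
  · rintro ⟨p, hp⟩
    have hlim (x y : X) : Tendsto (fun n => dist (τ^[n] x) (τ^[n] y)) atTop (𝓝 0) := by
      simpa using (hp x).dist (hp y)
    refine ⟨fun x y => ⟨0, hlim x y⟩, fun x y hxy L hL h => hxy ?_⟩
    rw [← dist_eq_zero, ← h]
    exact tendsto_nhds_unique hL (hlim x y)
  · rintro ⟨hconv, hne⟩
    obtain ⟨p, hp⟩ := hfix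
    have hpn (n : ℕ) : τ^[n] p = p := Function.iterate_fixed hp n
    refine ⟨p, fun x => le_nhds_of_unique_clusterPt fun z hz => ?_⟩
    obtain ⟨L, hL⟩ := hconv x p
    simp only [hpn] at hL
    obtain ⟨φ, hφ, hz⟩ := MapClusterPt.tendsto_subseq
      (show MapClusterPt z atTop (fun n => τ^[n] x) from hz)
    have hdist (m : ℕ) : dist (τ^[m] z) p = L := by
      have h₁ : Tendsto (fun k => dist (τ^[m + φ k] x) p) atTop (𝓝 (dist (τ^[m] z) p)) := by
        simp only [Function.iterate_add_apply]
        exact (((hτ.iterate m).tendsto z).comp hz).dist tendsto_const_nhds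
      have h₂ : Tendsto (fun k => m + φ k) atTop atTop :=
        tendsto_atTop_mono (fun k => Nat.le_add_left (φ k) m) hφ.tendsto_atTop
      exact tendsto_nhds_unique h₁ (hL.comp h₂)
    by_contra hzp
    refine hne z p hzp L ?_ (hdist 0).symm
    simp only [hpn, hdist]
    exact tendsto_const_nhds
end
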